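/- arXiv:1601.07812 — 2 statements merged into one kernel-verified Lean document; each statement's English description precedes it below -/
import Mathlib

section
/- For n = 3k+1 with k ≥ 1, the maximal order of an abelian subgroup of the symmetric group S_n is 4·3^(k-1), and any abelian subgroup attaining this order is isomorphic to either (Z/3)^(k-1) × (Z/4) or (Z/3)^(k-1) × (Z/2)^2. -/
def GG : ℕ → ℕ
  | 0 => 1 | 1 => 1 | 2 => 2 | 3 => 3 | 4 => 4
  | (n+5) => 3 * GG (n+2)

lemma GG_three (n : ℕ) (h : 2 ≤ n) : GG (n+3) = 3 * GG n := by
  obtain ⟨m, rfl⟩ := Nat.exists_eq_add_of_le' h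
  rw [show m + 2 + 3 = m + 5 by ring]; simp [GG]

lemma GG_pos (n : ℕ) : 1 ≤ GG n := by
  induction n using GG.induct <;> simp [GG] <;> omega

lemma GG_one (n : ℕ) (h : 1 ≤ n) : GG n < GG (n+1) := by
  induction n using GG.induct with
  | case6 n ih => change GG (n+5) < GG (n+5+1); rw [show n+5 = (n+2)+3 by ring, GG_three _ (by omega), show n+2+3+1 = (n+2+1)+3 by ring, GG_three _ (by omega)]; have := ih (by omega); simp only [add_assoc, Nat.reduceAdd] at *; omega
  | _ => simp [GG] at *

lemma GG_two (n : ℕ) : 2 * GG n ≤ GG (n+2) := by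
  induction n using GG.induct with
  | case6 n ih => change 2 * GG (n+5) ≤ GG (n+5+2); rw [show n+5 = (n+2)+3 by ring, GG_three _ (by omega), show n+2+3+2 = (n+2+2)+3 by ring, GG_three _ (by omega)]; simp only [add_assoc, Nat.reduceAdd] at *; omega
  | _ => simp [GG] at *

lemma GG_le (a m : ℕ) : a * GG m ≤ GG (a + m) ∧ (5 ≤ a → a * GG m < GG (a+m)) := by
  induction a using GG.induct with
  | case1 => simp
  | case2 => 
    simp
    rcases m with _ | m
    · simp [GG]
    · rw [add_comm 1]; exact (GG_one _ (by omega)).le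
  | case3 => simpa [add_comm] using GG_two m
  | case4 => 
    rcases m with _ | _ | m
    · simp [GG]
    · simp [GG]
    · rw [add_comm 3, GG_three _ (by omega)]; simp
  | case5 => 
    have := GG_two m
    have := GG_two (m+2)
    rw [add_comm 4]
    rw [add_assoc] at this
    simp at *; omega
  | case6 n ih => 
    have h1 := ih.1
    change (n+5) * GG m ≤ GG (n+5+m) ∧ (5 ≤ n+5 → (n+5) * GG m < GG (n+5+m))
    rw [show n + 5 + m = (n+2+m)+3 by ring, GG_three _ (by omega)]
    have h2 := GG_pos m
    have : (n+5) * GG m < 3 * ((n+2) * GG m) := by nlinarith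
    constructor
    · omega
    · intro _; omega

lemma GG_val (k : ℕ) : GG (3 * (k+1) + 1) = 4 * 3^k := by
  induction k with
  | zero => simp [GG]
  | succ k ih => rw [show 3 * (k+1+1)+1 = (3*(k+1)+1)+3 by ring, GG_three _ (by omega), ih]; ring

lemma prod_le_GG {ι : Type*} (s : Finset ι) (f : ι → ℕ) : ∏ i ∈ s, f i ≤ GG (∑ i ∈ s, f i) := by
  classical
  induction s using Finset.induction_on with
  | empty => simp [GG]
  | insert a s ha ih =>
    rw [Finset.prod_insert ha, Finset.sum_insert ha]
    exact (Nat.mul_le_mul_left _ ih).trans (GG_le _ _).1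

lemma dvd_twelve {ι : Type*} [Fintype ι] (f : ι → ℕ) (hf : ∀ i, 1 ≤ f i) (h2 : 2 ≤ ∑ i, f i)
    (h : ∏ i, f i = GG (∑ i, f i)) (i : ι) : f i ∣ 12 := by
  classical
  rw [← Finset.mul_prod_erase _ _ (Finset.mem_univ i)] at h
  rw [← Finset.add_sum_erase _ _ (Finset.mem_univ i)] at h h2
  have h1 := prod_le_GG (Finset.univ.erase i) f
  generalize ∑ x ∈ Finset.univ.erase i, f x = m at *
  generalize ∏ x ∈ Finset.univ.erase i, f x = p at *
  have h3 := hf i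
  generalize f i = a at *
  have h4 := Nat.mul_le_mul_left a h1
  have h5 := (GG_le a m).2
  have : a < 5 := by by_contra; have := h5 (by omega); omega
  have h6 : a ≠ 1 := by
    rintro rfl
    have := GG_one m (by omega)
    rw [add_comm 1] at h
    omega
  interval_cases a <;> first | omega | decide

open MulAction in
lemma perm_bound {n : ℕ} (M : Subgroup (Equiv.Perm (Fin n))) (hM : ∀ a b : M, a * b = b * a) :
    Nat.card M ≤ GG n ∧ (2 ≤ n → Nat.card M = GG n → ∀ g : M, g ^ 12 = 1) := by
  classical
  let f : orbitRel.Quotient M (Fin n) → ℕ := fun ω => Nat.card ω.orbit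
  have hsum : ∑ ω, f ω = n := by
    have := Nat.card_congr (selfEquivSigmaOrbits' M (Fin n))
    rw [Nat.card_sigma] at this
    rw [Nat.card_fin] at this
    exact this.symm
  let φ : M → (∀ ω : orbitRel.Quotient M (Fin n), ω.orbit) := fun g ω =>
    ⟨g • ω.out, by rw [orbitRel.Quotient.orbit_eq_orbit_out _ Quotient.out_eq']; exact ⟨g, rfl⟩⟩
  have key : ∀ g h : M, (∀ ω : orbitRel.Quotient M (Fin n), g • ω.out = h • ω.out) → g = h := by
    intro g h H
    have : ∀ x : Fin n, g • x = h • x := by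
      intro x
      have hx := orbitRel.Quotient.mem_orbit.2 (rfl : (Quotient.mk'' x : orbitRel.Quotient M (Fin n)) = _)
      rw [orbitRel.Quotient.orbit_eq_orbit_out _ Quotient.out_eq'] at hx
      obtain ⟨m, hm⟩ := hx
      simp only at hm
      rw [← hm, ← mul_smul, ← mul_smul, hM g, hM h, mul_smul, mul_smul, H]
    exact Subtype.ext (Equiv.ext this)
  have hφ : Function.Injective φ := fun g h hgh => key g h fun ω =>
    congrArg Subtype.val (congrFun hgh ω)
  have hle : Nat.card M ≤ ∏ ω, f ω := by
    have := Nat.card_le_card_of_injective φ hφ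
    rwa [Nat.card_pi] at this
  have hb := prod_le_GG Finset.univ f
  rw [hsum] at hb
  refine ⟨hle.trans hb, fun hn hc g => key _ _ fun ω => ?_⟩
  have hpos : ∀ ω, 1 ≤ f ω := by
    intro ω
    have : Nonempty ω.orbit := ⟨φ 1 ω⟩
    exact Nat.card_pos
  have hd := dvd_twelve f hpos (by omega) (by rw [hsum]; omega) ω
  let _ : CommGroup M := { (inferInstance : Group M) with mul_comm := hM }
  have h1 : (stabilizer M ω.out).index = f ω := by
    rw [index_stabilizer, ← orbitRel.Quotient.orbit_eq_orbit_out _ Quotient.out_eq']; rfl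
  have h2 := Subgroup.pow_index_mem (stabilizer M ω.out) g
  rw [h1] at h2
  obtain ⟨c, hc⟩ := hd
  rw [hc, pow_mul, one_smul]
  exact Subgroup.pow_mem _ h2 c


lemma exists_sub (k : ℕ) : ∃ M : Subgroup (Equiv.Perm (Fin (3*(k+1)+1))),
    (∀ a b : M, a * b = b * a) ∧ Nat.card M = 4 * 3 ^ k := by
  let A := Multiplicative (ZMod 3)
  let B := Multiplicative (ZMod 4)
  have hc : Nat.card ((Σ _ : Fin k, A) ⊕ B) = 3*(k+1)+1 := by
    rw [Nat.card_sum, Nat.card_sigma]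
    simp [A, B]
    ring
  have : Finite ((Σ _ : Fin k, A) ⊕ B) := by
    apply Nat.finite_of_card_ne_zero; omega
  let e : ((Σ _ : Fin k, A) ⊕ B) ≃ Fin (3*(k+1)+1) := Finite.equivFinOfCardEq hc
  let ψ : ((Fin k → A) × B) →* Equiv.Perm (Fin (3*(k+1)+1)) :=
    (e.permCongrHom.toMonoidHom.comp (Equiv.Perm.sumCongrHom _ _)).comp
      (MonoidHom.prodMap ((Equiv.Perm.sigmaCongrRightHom (fun _ : Fin k => A)).comp
        ((MulAction.toPermHom A A).compLeft (Fin k))) (MulAction.toPermHom B B))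
  have hψ : Function.Injective ψ := by
    refine (e.permCongrHom.injective.comp Equiv.Perm.sumCongrHom_injective).comp
      (Function.Injective.prodMap (Equiv.Perm.sigmaCongrRightHom_injective.comp ?_)
        MulAction.toPerm_injective)
    intro x y h
    funext i
    exact MulAction.toPerm_injective (congrFun h i)
  refine ⟨ψ.range, ?_, ?_⟩
  · rintro ⟨_, a, rfl⟩ ⟨_, b, rfl⟩
    apply Subtype.ext
    simp only [Subgroup.coe_mul, ← map_mul, mul_comm]
  · rw [← Nat.card_congr (MonoidHom.ofInjective hψ).toEquiv, Nat.card_prod, Nat.card_pi]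
    simp [A, B, mul_comm]

lemma elem3 (G : Type*) [CommGroup G] [Finite G] (h : ∀ g : G, g ^ 3 = 1) :
    ∃ d, Nonempty (G ≃* (Fin d → Multiplicative (ZMod 3))) := by
  let _ : Module (ZMod 3) (Additive G) := AddCommGroup.zmodModule (n := 3) fun x => h x.toMul
  have : Module.Finite (ZMod 3) (Additive G) := Module.Finite.of_finite
  let e := (Module.finBasis (ZMod 3) (Additive G)).equivFun
  refine ⟨_, ⟨⟨⟨fun g i => Multiplicative.ofAdd (e (Additive.ofMul g) i),
    fun v => (e.symm fun i => (v i).toAdd).toMul, fun g => ?_, fun v => ?_⟩, fun g h => ?_⟩⟩⟩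
  · simp
  · simp
  · funext i
    simp

lemma four (G : Type*) [CommGroup G] (h : Nat.card G = 4) :
    Nonempty (G ≃* Multiplicative (ZMod 4)) ∨
    Nonempty (G ≃* (Multiplicative (ZMod 2) × Multiplicative (ZMod 2))) := by
  have : Finite G := Nat.finite_of_card_ne_zero (by omega)
  by_cases hc : IsCyclic G
  · left
    exact ⟨mulEquivOfCyclicCardEq (by simp [h])⟩
  · right
    have : IsKleinFour G := ⟨h, by
      have h1 : Monoid.exponent G ∣ 2^2 := by
        have := Group.exponent_dvd_nat_card (G := G)
        rwa [h] at this
      obtain ⟨j, hj, h2⟩ := (Nat.dvd_prime_pow Nat.prime_two).1 h1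
      interval_cases j
      · exfalso
        have := Monoid.exp_eq_one_iff.1 h2
        have := Nat.card_of_subsingleton (1 : G)
        omega
      · exact h2
      · exfalso
        exact hc (IsCyclic.of_exponent_eq_card (by rw [h2, h]; rfl))⟩
    have : IsKleinFour (Multiplicative (ZMod 2) × Multiplicative (ZMod 2)) := ⟨by simp, by
      rw [Monoid.exponent_prod]; simp⟩
    exact IsKleinFour.nonempty_mulEquiv

lemma struct (k : ℕ) (G : Type*) [CommGroup G] (hG : Nat.card G = 4 * 3 ^ k)
    (h : ∀ g : G, g ^ 12 = 1) :
    Nonempty (G ≃* ((Fin k → Multiplicative (ZMod 3)) × Multiplicative (ZMod 4))) ∨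
    Nonempty (G ≃* ((Fin k → Multiplicative (ZMod 3)) ×
          (Multiplicative (ZMod 2) × Multiplicative (ZMod 2)))) := by
  have : Finite G := Nat.finite_of_card_ne_zero (by rw [hG]; positivity)
  let H : Subgroup G := (powMonoidHom 3 : G →* G).ker
  let K : Subgroup G := (powMonoidHom 4 : G →* G).ker
  have hH : ∀ g : H, g ^ 3 = 1 := fun g => Subtype.ext g.2
  have hK : ∀ g : K, g ^ 4 = 1 := fun g => Subtype.ext g.2
  let m : H × K →* G := H.subtype.coprod K.subtype
  have hm : Function.Bijective m := by
    constructor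
    · rw [injective_iff_map_eq_one]
      rintro ⟨⟨a, ha⟩, ⟨b, hb⟩⟩ hab
      replace ha : a ^ 3 = 1 := ha
      replace hb : b ^ 4 = 1 := hb
      replace hab : a * b = 1 := hab
      have h1 : a = 1 := by
        calc a = (a * b) ^ 4 * ((a ^ 3)⁻¹ * (b ^ 4)⁻¹) := by
              rw [mul_pow, ha, hb, pow_succ, ha]; simp
          _ = 1 := by rw [ha, hb, hab]; simp
      subst h1
      have h2 : b = 1 := by simpa using hab
      subst h2
      rfl
    · intro g
      refine ⟨(⟨g ^ 4, ?_⟩, ⟨g ^ 9, ?_⟩), ?_⟩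
      · change (g ^ 4) ^ 3 = 1
        rw [← pow_mul, h]
      · change (g ^ 9) ^ 4 = 1
        rw [← pow_mul, show 9 * 4 = 12 * 3 by rfl, pow_mul, h, one_pow]
      · change g ^ 4 * g ^ 9 = g
        rw [← pow_add, show 4 + 9 = 12 + 1 by rfl, pow_succ, h, one_mul]
  let E := MulEquiv.ofBijective m hm
  obtain ⟨d, ⟨e⟩⟩ := elem3 H hH
  have cH : Nat.card H = 3 ^ d := by rw [Nat.card_congr e.toEquiv, Nat.card_pi]; simp
  have cE : 3 ^ d * Nat.card K = 4 * 3 ^ k := by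
    rw [← hG, ← Nat.card_congr E.toEquiv, Nat.card_prod, cH]
  have hK3 : ¬ 3 ∣ Nat.card K := by
    intro h3
    have : Fact (Nat.Prime 3) := ⟨Nat.prime_three⟩
    obtain ⟨x, hx⟩ := exists_prime_orderOf_dvd_card' 3 h3
    have := orderOf_dvd_of_pow_eq_one (hK x)
    rw [hx] at this
    omega
  have cop : Nat.Coprime 3 (Nat.card K) := (Nat.Prime.coprime_iff_not_dvd Nat.prime_three).2 hK3
  have hd1 : 3 ^ d ∣ 3 ^ k :=
    (Nat.Coprime.pow_left d (by norm_num : Nat.Coprime 3 4)).dvd_of_dvd_mul_left ⟨_, cE.symm⟩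
  have hd2 : 3 ^ k ∣ 3 ^ d := (Nat.Coprime.pow_left k cop).dvd_of_dvd_mul_right ⟨4, by rw [cE, mul_comm]⟩
  have hd : d = k := Nat.pow_right_injective (le_refl 2 |>.trans (by norm_num)) (Nat.dvd_antisymm hd1 hd2)
  subst hd
  have cK : Nat.card K = 4 := by
    rw [mul_comm] at cE
    exact Nat.eq_of_mul_eq_mul_right (by positivity) cE
  rcases four K cK with ⟨⟨f⟩⟩ | ⟨⟨f⟩⟩
  · exact Or.inl ⟨E.symm.trans (e.prodCongr f)⟩
  · exact Or.inr ⟨E.symm.trans (e.prodCongr f)⟩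

/-- For `n = 3k+1` with `k ≥ 1`, the maximal order of an abelian subgroup of `S_n`
is `4·3^(k-1)`, and any abelian subgroup attaining this order is isomorphic to
either `(ℤ/3)^(k-1) × ℤ/4` or `(ℤ/3)^(k-1) × (ℤ/2)^2`. -/
theorem maximal_abelian_symmetric_three_k_add_one (k n : ℕ) (hk : 1 ≤ k)
    (hn : n = 3 * k + 1) :
    IsGreatest {m : ℕ | ∃ M : Subgroup (Equiv.Perm (Fin n)),
        (∀ a b : M, a * b = b * a) ∧ Nat.card M = m} (4 * 3 ^ (k - 1)) ∧
    ∀ M : Subgroup (Equiv.Perm (Fin n)), (∀ a b : M, a * b = b * a) →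
      Nat.card M = 4 * 3 ^ (k - 1) →
      (Nonempty (M ≃* ((Fin (k - 1) → Multiplicative (ZMod 3)) × Multiplicative (ZMod 4))) ∨
       Nonempty (M ≃* ((Fin (k - 1) → Multiplicative (ZMod 3)) ×
          (Multiplicative (ZMod 2) × Multiplicative (ZMod 2))))) := by
  obtain ⟨k, rfl⟩ := Nat.exists_eq_add_of_le' hk
  subst hn
  simp only [Nat.add_sub_cancel]
  refine ⟨⟨exists_sub k, ?_⟩, ?_⟩
  · rintro m ⟨M, hM, rfl⟩
    rw [← GG_val]
    exact (perm_bound M hM).1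
  · intro M hM hc
    have h12 := (perm_bound M hM).2 (by omega) (by rw [hc, GG_val])
    let _ : CommGroup M := { (inferInstance : Group M) with mul_comm := hM }
    exact struct k M hc h12
end

section
/- The automorphism group of the Fano plane (the projective plane over the field with two elements) is isomorphic to PSL(2,7) (equivalently PSL(3,2)), a simple group of order 168. -/
open Pointwise

/-- The points of the Fano plane: nonzero vectors of `(𝔽₂)³`. -/
def FanoPoint : Type := {v : Fin 3 → ZMod 2 // v ≠ 0}

instance : DecidableEq FanoPoint := by unfold FanoPoint; infer_instance
instance : Fintype FanoPoint := by unfold FanoPoint; infer_instance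

/-- The collinear triples of points of the Fano plane: three (not necessarily
distinct listed) points summing to zero. -/
def FanoCollinear : Set (FanoPoint × FanoPoint × FanoPoint) :=
  {t | t.1.1 + t.2.1.1 + t.2.2.1 = 0}

/-- The automorphism group of the Fano plane: permutations of the points
preserving collinearity. -/
def FanoAut : Subgroup (Equiv.Perm FanoPoint) :=
  MulAction.stabilizer (Equiv.Perm FanoPoint) FanoCollinear

open Matrix in
/-- The images of the upper unipotent matrices of `SL(2,7)`. -/
def fanoUm : ZMod 7 → Matrix (Fin 3) (Fin 3) (ZMod 2) :=
  show Fin 7 → Matrix (Fin 3) (Fin 3) (ZMod 2) from ![!![1, 0, 0; 0, 1, 0; 0, 0, 1],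
    !![0, 0, 1; 0, 1, 1; 1, 1, 0],
    !![1, 1, 0; 1, 0, 1; 0, 1, 0],
    !![0, 1, 0; 1, 1, 1; 0, 1, 1],
    !![0, 1, 1; 1, 0, 0; 1, 0, 1],
    !![1, 0, 1; 0, 0, 1; 1, 1, 1],
    !![1, 1, 1; 1, 1, 0; 1, 0, 0]]

open Matrix in
/-- The images of the diagonal matrices of `SL(2,7)`. -/
def fanoDm : ZMod 7 → Matrix (Fin 3) (Fin 3) (ZMod 2) :=
  show Fin 7 → Matrix (Fin 3) (Fin 3) (ZMod 2) from ![!![1, 0, 0; 0, 1, 0; 0, 0, 1],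
    !![1, 0, 0; 0, 1, 0; 0, 0, 1],
    !![0, 0, 1; 1, 0, 0; 0, 1, 0],
    !![0, 1, 0; 0, 0, 1; 1, 0, 0],
    !![0, 1, 0; 0, 0, 1; 1, 0, 0],
    !![0, 0, 1; 1, 0, 0; 0, 1, 0],
    !![1, 0, 0; 0, 1, 0; 0, 0, 1]]

/-- The group `SL(3,2)`. -/
abbrev FanoSL3 := Matrix.SpecialLinearGroup (Fin 3) (ZMod 2)

/-- The group `SL(2,7)`. -/
abbrev FanoSL2 := Matrix.SpecialLinearGroup (Fin 2) (ZMod 7)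

def fanoU (x : ZMod 7) : FanoSL3 :=
  ⟨fanoUm x, by rw [Matrix.det_fin_three]; revert x; decide⟩

def fanoD (x : ZMod 7) : FanoSL3 :=
  ⟨fanoDm x, by rw [Matrix.det_fin_three]; revert x; decide⟩

def fanoW : FanoSL3 :=
  ⟨!![0, 1, 0; 1, 0, 0; 0, 0, 1], by rw [Matrix.det_fin_three]; decide⟩

theorem fanoU_add (x y : ZMod 7) : fanoU (x + y) = fanoU x * fanoU y := by
  apply Subtype.ext
  change fanoUm (x + y) = fanoUm x * fanoUm y
  revert x y
  decide +kernel

theorem fanoU_zero : fanoU 0 = 1 := by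
  apply Subtype.ext
  change fanoUm 0 = 1
  decide +kernel

theorem fanoD_mul (x y : ZMod 7) (hx : x ≠ 0) (hy : y ≠ 0) :
    fanoD (x * y) = fanoD x * fanoD y := by
  apply Subtype.ext
  change fanoDm (x * y) = fanoDm x * fanoDm y
  revert x y
  decide +kernel

theorem fanoD_neg (x : ZMod 7) : fanoD (-x) = fanoD x := by
  apply Subtype.ext
  change fanoDm (-x) = fanoDm x
  revert x
  decide +kernel

theorem fanoD_U (a x : ZMod 7) (ha : a ≠ 0) :
    fanoD a * fanoU x = fanoU (a ^ 2 * x) * fanoD a := by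
  apply Subtype.ext
  change fanoDm a * fanoUm x = fanoUm (a ^ 2 * x) * fanoDm a
  revert a x
  decide +kernel

theorem fanoW_W : fanoW * fanoW = 1 := by
  apply Subtype.ext
  change fanoW.1 * fanoW.1 = 1
  decide +kernel

theorem fanoD_W (a : ZMod 7) (ha : a ≠ 0) :
    fanoD a * fanoW = fanoW * fanoD (a ^ 5) := by
  apply Subtype.ext
  change fanoDm a * fanoW.1 = fanoW.1 * fanoDm (a ^ 5)
  revert a
  decide +kernel

theorem fanoW_U_W (k j : ZMod 7) (h : k * j = 1) :
    fanoW * (fanoU k * fanoW) = fanoU (-j) * (fanoW * (fanoD k * fanoU (-j))) := by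
  apply Subtype.ext
  change fanoW.1 * (fanoUm k * fanoW.1) = fanoUm (-j) * (fanoW.1 * (fanoDm k * fanoUm (-j)))
  revert k j
  decide +kernel

/-- The homomorphism on coordinates, given through the Bruhat decomposition. -/
def fanoF (a b c d : ZMod 7) : FanoSL3 :=
  if c = 0 then fanoU (a * b) * fanoD a
  else fanoU (a * c ^ 5) * (fanoW * (fanoD c * fanoU (d * c ^ 5)))

theorem fano_pow_six (a : ZMod 7) (ha : a ≠ 0) : a ^ 6 = 1 := by
  revert a; decide

theorem fanoF_U (k a b c d : ZMod 7) (h : a * d - b * c = 1) :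
    fanoF (a + k * c) (b + k * d) c d = fanoU k * fanoF a b c d := by
  unfold fanoF
  split_ifs with hc
  · subst hc
    rw [← mul_assoc (fanoU k), ← fanoU_add]
    congr 2
    · grind
    · grind
  · have := fano_pow_six c hc
    rw [← mul_assoc (fanoU k), ← fanoU_add]
    congr 2
    grind

theorem fanoF_D (e a b c d : ZMod 7) (he : e ≠ 0) (h : a * d - b * c = 1) :
    fanoF (e * a) (e * b) (e ^ 5 * c) (e ^ 5 * d) = fanoD e * fanoF a b c d := by
  have he6 := fano_pow_six e he
  have : Fact (Nat.Prime 7) := ⟨by norm_num⟩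
  have he5 : e ^ 5 ≠ 0 := pow_ne_zero _ he
  unfold fanoF
  by_cases hc : c = 0
  · subst hc
    have ha : a ≠ 0 := by rintro rfl; simp at h
    rw [if_pos (by simp), if_pos rfl, ← mul_assoc (fanoD e), fanoD_U _ _ he, mul_assoc (fanoU _), ← fanoD_mul _ _ he ha]
    congr 2
    ring
  · have hc6 := fano_pow_six c hc
    rw [if_neg (mul_ne_zero he5 hc), if_neg hc, ← mul_assoc (fanoD e), fanoD_U _ _ he, mul_assoc (fanoU _),
      ← mul_assoc (fanoD e), fanoD_W _ he, mul_assoc fanoW, ← mul_assoc (fanoD (e ^ 5)),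
      ← fanoD_mul _ _ he5 hc]
    have h1 : e * a * (e ^ 5 * c) ^ 5 = e ^ 2 * (a * c ^ 5) := by
      have : e ^ 26 = e ^ 2 := by
        calc e ^ 26 = (e ^ 6) ^ 4 * e ^ 2 := by ring
          _ = e ^ 2 := by rw [he6]; ring
      linear_combination a * c ^ 5 * this
    have h2 : e ^ 5 * d * (e ^ 5 * c) ^ 5 = d * c ^ 5 := by
      have : e ^ 30 = 1 := by
        calc e ^ 30 = (e ^ 6) ^ 5 := by ring
          _ = 1 := by rw [he6]; ring
      linear_combination d * c ^ 5 * this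
    rw [h1, h2]

theorem fanoF_W (a b c d : ZMod 7) (h : a * d - b * c = 1) :
    fanoF (-c) (-d) a b = fanoW * fanoF a b c d := by
  have : Fact (Nat.Prime 7) := ⟨by norm_num⟩
  unfold fanoF
  by_cases hc : c = 0
  · subst hc
    have ha : a ≠ 0 := by rintro rfl; simp at h
    have ha6 := fano_pow_six a ha
    rw [if_neg ha, if_pos rfl, fanoD_U _ _ ha]
    have : a ^ 2 * (b * a ^ 5) = a * b := by linear_combination a * b * ha6
    rw [this]
    simp [fanoU_zero]
  · have hc6 := fano_pow_six c hc
    by_cases ha : a = 0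
    · subst ha
      rw [if_pos rfl, if_neg hc, fanoD_U _ _ hc, fanoD_neg, zero_mul, fanoU_zero, one_mul,
        ← mul_assoc fanoW fanoW, fanoW_W, one_mul]
      congr 2
      linear_combination (-c * d) * hc6
    · have ha6 := fano_pow_six a ha
      have hac : a * c ^ 5 ≠ 0 := mul_ne_zero ha (pow_ne_zero _ hc)
      rw [if_neg ha, if_neg hc, ← mul_assoc (fanoU (a * c ^ 5)), ← mul_assoc fanoW (fanoU _ * _),
        fanoW_U_W (a * c ^ 5) (c * a ^ 5) (by linear_combination a ^ 6 * hc6 + ha6)]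
      have h1 : fanoU (-(c * a ^ 5)) * fanoD c = fanoD c * fanoU (-(c ^ 5 * a ^ 5)) := by
        rw [fanoD_U _ _ hc]
        congr 2
        linear_combination c * a ^ 5 * hc6
      have h2 : fanoD (a * c ^ 5) * fanoD c = fanoD a := by
        rw [← fanoD_mul _ _ hac hc]
        congr 1
        linear_combination a * hc6
      have h3 : b * a ^ 5 = -(c ^ 5 * a ^ 5) + d * c ^ 5 := by
        linear_combination -(a ^ 5 * c ^ 5) * h + d * c ^ 5 * ha6 - b * a ^ 5 * hc6
      rw [h3, fanoU_add (-(c ^ 5 * a ^ 5)), ← h2]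
      simp only [mul_assoc]
      rw [← mul_assoc (fanoU (-(c * a ^ 5))) (fanoD c), h1]
      simp only [mul_assoc, neg_mul]

theorem fanoF_mul (a b c d p q r s : ZMod 7) (h : a * d - b * c = 1) (h' : p * s - q * r = 1) :
    fanoF (a * p + b * r) (a * q + b * s) (c * p + d * r) (c * q + d * s) =
      fanoF a b c d * fanoF p q r s := by
  have : Fact (Nat.Prime 7) := ⟨by norm_num⟩
  by_cases hc : c = 0
  · subst hc
    have ha : a ≠ 0 := by rintro rfl; simp at h
    have ha6 := fano_pow_six a ha
    have hd : d = a ^ 5 := by linear_combination a ^ 5 * h - d * ha6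
    have e : fanoF a b 0 d = fanoU (a * b) * fanoD a := by simp [fanoF]
    rw [e, mul_assoc, ← fanoF_D _ _ _ _ _ ha h',
      ← fanoF_U _ _ _ _ _ (by linear_combination a ^ 6 * h' + ha6), hd]
    congr 1
    · linear_combination (-b * r) * ha6
    · linear_combination (-b * s) * ha6
    · ring
    · ring
  · have hc6 := fano_pow_six c hc
    have e : fanoF a b c d = fanoU (a * c ^ 5) * (fanoW * (fanoD c * fanoU (d * c ^ 5))) := by
      simp [fanoF, hc]
    rw [e]
    simp only [mul_assoc]
    rw [← fanoF_U _ _ _ _ _ h',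
      ← fanoF_D _ _ _ _ _ hc (by linear_combination h'),
      ← fanoF_W _ _ _ _ (by linear_combination c ^ 6 * h' + hc6),
      ← fanoF_U _ _ _ _ _ (by linear_combination c ^ 6 * h' + hc6)]
    congr 1
    · linear_combination (-c ^ 5 * r) * h - (b * r + a * p + a * d * c ^ 5 * r) * hc6
    · linear_combination (-c ^ 5 * s) * h - (b * s + a * q + a * d * c ^ 5 * s) * hc6
    · linear_combination (-d * r) * hc6
    · linear_combination (-d * s) * hc6

/-- The homomorphism `SL(2,7) → SL(3,2)`. -/
def fanoHom : FanoSL2 →* FanoSL3 :=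
  MonoidHom.mk' (fun M => fanoF (M.1 0 0) (M.1 0 1) (M.1 1 0) (M.1 1 1)) (by
    intro x y
    have hx := x.2
    have hy := y.2
    rw [Matrix.det_fin_two] at hx hy
    rw [← fanoF_mul _ _ _ _ _ _ _ _ hx hy]
    simp [Matrix.mul_apply, Fin.sum_univ_two])

theorem fanoHom_center (x : FanoSL2) (hx : x ∈ Subgroup.center FanoSL2) : fanoHom x = 1 := by
  obtain ⟨r, hr, hx⟩ := Matrix.SpecialLinearGroup.mem_center_iff.1 hx
  have h : fanoHom x = fanoF (x.1 0 0) (x.1 0 1) (x.1 1 0) (x.1 1 1) := rfl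
  rw [h, ← hx]
  simp only [Matrix.scalar_apply, Matrix.diagonal_apply, fanoF]
  simp only [Fintype.card_fin] at hr
  simp only [if_true, one_ne_zero, zero_ne_one, if_false, mul_zero, fanoU_zero, one_mul]
  apply Subtype.ext
  change fanoDm r = 1
  clear hx h
  revert r
  decide +kernel

open MatrixGroups in
/-- The induced homomorphism `PSL(2,7) → SL(3,2)`. -/
def fanoPHom : PSL(2, ZMod 7) →* FanoSL3 :=
  QuotientGroup.lift (Subgroup.center FanoSL2) fanoHom fanoHom_center

open MatrixGroups in
theorem fanoPSL_simple : IsSimpleGroup PSL(2, ZMod 7) := by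
  have : Fact (Nat.Prime 7) := ⟨by norm_num⟩
  exact Matrix.ProjectiveSpecialLinearGroup.rank_two_simple (by simp)

theorem fanoPHom_injective : Function.Injective fanoPHom := by
  have := fanoPSL_simple
  rw [← MonoidHom.ker_eq_bot_iff]
  refine (this.eq_bot_or_eq_top_of_normal _ inferInstance).resolve_right fun h => ?_
  let u : FanoSL2 := ⟨!![1, 1; 0, 1], by simp [Matrix.det_fin_two]⟩
  have h1 : QuotientGroup.mk u ∈ fanoPHom.ker := by rw [h]; trivial
  have h2 : fanoU (1 * 1) * fanoD 1 = 1 := h1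
  have h3 := congrArg Subtype.val h2
  change fanoUm (1 * 1) * fanoDm 1 = 1 at h3
  revert h3
  decide +kernel

theorem fano_card_SL2 : Nat.card FanoSL2 = 336 := by
  let e : FanoSL2 ≃ {p : ZMod 7 × ZMod 7 × ZMod 7 × ZMod 7 //
      p.1 * p.2.2.2 - p.2.1 * p.2.2.1 = 1} :=
    { toFun := fun M => ⟨(M.1 0 0, M.1 0 1, M.1 1 0, M.1 1 1), by
        have := M.2; rwa [Matrix.det_fin_two] at this⟩
      invFun := fun p => ⟨!![p.1.1, p.1.2.1; p.1.2.2.1, p.1.2.2.2], by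
        rw [Matrix.det_fin_two]; simpa using p.2⟩
      left_inv := fun M => by
        ext i j; fin_cases i <;> fin_cases j <;> rfl
      right_inv := fun p => by
        simp }
  rw [Nat.card_congr e, Nat.card_eq_fintype_card]
  decide +kernel

theorem fano_zmod_two : ∀ x : ZMod 2, x ≠ 0 → x = 1 := by decide

theorem fano_card_SL3 : Nat.card FanoSL3 = 168 := by
  have : Fact (Nat.Prime 2) := ⟨by norm_num⟩
  have hb : Function.Bijective
      (Matrix.SpecialLinearGroup.toGL : FanoSL3 →* Matrix.GeneralLinearGroup (Fin 3) (ZMod 2)) := by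
    refine ⟨Matrix.SpecialLinearGroup.toGL_injective, fun g => ?_⟩
    have h0 : g.1.det ≠ 0 := ((Matrix.isUnit_iff_isUnit_det _).1 g.isUnit).ne_zero
    exact ⟨⟨g.1, fano_zmod_two _ h0⟩, Units.ext rfl⟩
  rw [Nat.card_congr (Equiv.ofBijective _ hb), Matrix.card_GL_field]
  simp [Fin.prod_univ_three]

theorem fano_card_center : Nat.card (Subgroup.center FanoSL2) ≤ 2 := by
  have : Fact (Nat.Prime 7) := ⟨by norm_num⟩
  rw [Nat.card_congr (Matrix.SpecialLinearGroup.center_equiv_rootsOfUnity' (0 : Fin 2)).toEquiv]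
  exact card_rootsOfUnity _ _

theorem fanoPHom_bijective : Function.Bijective fanoPHom := by
  rw [Nat.bijective_iff_injective_and_card]
  refine ⟨fanoPHom_injective, ?_⟩
  have h1 := Nat.card_le_card_of_injective _ fanoPHom_injective
  have h2 := Subgroup.card_eq_card_quotient_mul_card_subgroup (Subgroup.center FanoSL2)
  have h3 := fano_card_center
  rw [fano_card_SL2] at h2
  rw [fano_card_SL3] at h1 ⊢
  refine le_antisymm h1 ?_
  by_contra hlt
  push Not at hlt
  have := Nat.mul_le_mul (Nat.le_of_lt_succ hlt) h3
  have h4 : 336 ≤ 167 * 2 := h2.le.trans this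
  norm_num at h4

/-- The action of `SL(3,2)` on the points of the Fano plane. -/
abbrev fanoAction : MulAction FanoSL3 FanoPoint where
  smul A v := ⟨A • v.1, (smul_ne_zero_iff_ne A).2 v.2⟩
  one_smul v := Subtype.ext (one_smul FanoSL3 v.1)
  mul_smul A B v := Subtype.ext (mul_smul A B v.1)

/-- The permutation representation of `SL(3,2)` on the Fano plane. -/
def fanoPerm : FanoSL3 →* Equiv.Perm FanoPoint :=
  letI := fanoAction
  MulAction.toPermHom FanoSL3 FanoPoint

theorem fanoPerm_apply (A : FanoSL3) (v : FanoPoint) : (fanoPerm A v).1 = A • v.1 := rfl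

theorem fanoAut_iff (σ : Equiv.Perm FanoPoint) : σ ∈ FanoAut ↔
    ∀ a b c : FanoPoint, (σ a).1 + (σ b).1 + (σ c).1 = 0 ↔ a.1 + b.1 + c.1 = 0 := by
  unfold FanoAut
  rw [MulAction.mem_stabilizer_set]
  exact ⟨fun h a b c => h (a, b, c), fun h t => h t.1 t.2.1 t.2.2⟩

theorem fanoPerm_mem (A : FanoSL3) : fanoPerm A ∈ FanoAut := by
  rw [fanoAut_iff]
  intro a b c
  rw [fanoPerm_apply, fanoPerm_apply, fanoPerm_apply, ← smul_add, ← smul_add, smul_eq_zero_iff_eq]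

/-- The homomorphism from `SL(3,2)` to the automorphism group of the Fano plane. -/
def fanoAutHom : FanoSL3 →* FanoAut := fanoPerm.codRestrict FanoAut fanoPerm_mem

theorem fanoAutHom_injective : Function.Injective fanoAutHom := by
  intro A B h
  have h1 : ∀ v : FanoPoint, A • v.1 = B • v.1 := fun v => by
    have := congrArg (fun g : FanoAut => (g.1 v).1) h
    exact this
  apply Subtype.ext
  apply Matrix.ext_of_mulVec_single
  intro i
  exact h1 ⟨Pi.single i 1, by simp⟩

theorem fano_add_self (a : Fin 3 → ZMod 2) : a + a = 0 := CharTwo.add_self_eq_zero a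

/-- The extension by zero of a permutation of the points. -/
def fanoExt (σ : Equiv.Perm FanoPoint) (v : Fin 3 → ZMod 2) : Fin 3 → ZMod 2 :=
  if h : v = 0 then 0 else (σ ⟨v, h⟩).1

theorem fanoExt_add (σ : Equiv.Perm FanoPoint) (hσ : σ ∈ FanoAut) (a b : Fin 3 → ZMod 2) :
    fanoExt σ (a + b) = fanoExt σ a + fanoExt σ b := by
  rw [fanoAut_iff] at hσ
  by_cases ha : a = 0
  · simp [fanoExt, ha]
  by_cases hb : b = 0
  · simp [fanoExt, hb]
  by_cases hab : a + b = 0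
  · have : a = b := by
      rw [← sub_eq_zero, CharTwo.sub_eq_add]; exact hab
    subst this
    rw [hab, fano_add_self]
    simp [fanoExt]
  · have h := (hσ ⟨a, ha⟩ ⟨b, hb⟩ ⟨a + b, hab⟩).2 (fano_add_self _)
    simp only [fanoExt, ha, hb, hab, dif_neg, not_false_eq_true]
    rw [← sub_eq_zero, CharTwo.sub_eq_add, add_comm]
    exact h

theorem fanoExt_injective (σ : Equiv.Perm FanoPoint) : Function.Injective (fanoExt σ) := by
  intro a b h
  by_cases ha : a = 0 <;> by_cases hb : b = 0
  · rw [ha, hb]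
  · simp only [fanoExt, ha, hb, dif_neg, not_false_eq_true, dif_pos] at h
    exact absurd h.symm (σ ⟨b, hb⟩).2
  · simp only [fanoExt, ha, hb, dif_neg, not_false_eq_true, dif_pos] at h
    exact absurd h (σ ⟨a, ha⟩).2
  · simp only [fanoExt, ha, hb, dif_neg, not_false_eq_true] at h
    exact congrArg Subtype.val (σ.injective (Subtype.ext h))

theorem fanoAutHom_surjective : Function.Surjective fanoAutHom := by
  rintro ⟨σ, hσ⟩
  have : Fact (Nat.Prime 2) := ⟨by norm_num⟩
  let f : (Fin 3 → ZMod 2) →ₗ[ZMod 2] (Fin 3 → ZMod 2) :=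
    (AddMonoidHom.mk' (fanoExt σ) (fanoExt_add σ hσ)).toZModLinearMap 2
  have hf : Function.Injective f := fanoExt_injective σ
  have hM : (LinearMap.toMatrix' f).mulVec = fanoExt σ := by
    funext v
    rw [← Matrix.toLin'_apply, Matrix.toLin'_toMatrix']
    rfl
  have hdet : (LinearMap.toMatrix' f).det ≠ 0 := by
    have : IsUnit (LinearMap.toMatrix' f) := by
      rw [← Matrix.mulVec_injective_iff_isUnit, hM]
      exact fanoExt_injective σ
    exact ((Matrix.isUnit_iff_isUnit_det _).1 this).ne_zero
  refine ⟨⟨LinearMap.toMatrix' f, fano_zmod_two _ hdet⟩, ?_⟩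
  apply Subtype.ext
  apply Equiv.ext
  intro v
  apply Subtype.ext
  change (LinearMap.toMatrix' f).mulVec v.1 = (σ v).1
  rw [hM]
  have hv : v.1 ≠ 0 := v.2
  simp only [fanoExt, hv, dif_neg, not_false_eq_true]
  rfl

/-- `SL(3,2)` is the automorphism group of the Fano plane. -/
noncomputable def fanoEquiv : FanoSL3 ≃* FanoAut :=
  MulEquiv.ofBijective fanoAutHom ⟨fanoAutHom_injective, fanoAutHom_surjective⟩

theorem fano_center_SL3 : Subgroup.center FanoSL3 = ⊥ := by
  rw [eq_bot_iff]
  intro x hx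
  obtain ⟨r, hr, hx⟩ := Matrix.SpecialLinearGroup.mem_center_iff.1 hx
  have h0 : r ≠ 0 := by
    rintro rfl
    revert hr
    decide
  rw [fano_zmod_two r h0] at hx
  rw [Subgroup.mem_bot]
  apply Subtype.ext
  rw [← hx]
  simp

/-- The automorphism group of the Fano plane is isomorphic to `PSL(2,7)`
(equivalently `PSL(3,2)`), a simple group of order 168. -/
theorem fano_aut_iso_PSL :
    Nonempty (FanoAut ≃*
      (Matrix.SpecialLinearGroup (Fin 2) (ZMod 7) ⧸
        Subgroup.center (Matrix.SpecialLinearGroup (Fin 2) (ZMod 7)))) ∧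
    Nonempty (FanoAut ≃*
      (Matrix.SpecialLinearGroup (Fin 3) (ZMod 2) ⧸
        Subgroup.center (Matrix.SpecialLinearGroup (Fin 3) (ZMod 2)))) ∧
    IsSimpleGroup FanoAut ∧ Nat.card FanoAut = 168 := by
  have e2 : FanoAut ≃* Matrix.ProjectiveSpecialLinearGroup (Fin 2) (ZMod 7) :=
    fanoEquiv.symm.trans (MulEquiv.ofBijective fanoPHom fanoPHom_bijective).symm
  refine ⟨⟨e2⟩, ⟨?_⟩, ?_, ?_⟩
  · exact fanoEquiv.symm.trans
      (QuotientGroup.quotientBot.symm.trans (QuotientGroup.quotientMulEquivOfEq fano_center_SL3.symm))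
  · have := fanoPSL_simple
    exact e2.isSimpleGroup
  · rw [← Nat.card_congr fanoEquiv.toEquiv, fano_card_SL3]
end
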